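/- Let (X, Σ, m) be an atomless probability space such that card Σ ≤ card X and such that card Y = card X for every Y ∈ Σ with m(Y) > 0. Then there is a bijection x from the ordinals below the initial ordinal of cardinality card X onto X that captures the completion of (X, Σ, m): for every A ∈ Σ and every A' ⊆ X whose symmetric difference with A is contained in some B ∈ Σ with m(B) = 0, one has M̄(A'x) = m(A). -/

import Mathlib

open Ordinal

/-- The number `n` of full blocks in the standard decomposition `o = ω^σ·n + ρ`,
where `ω^σ = ω ^ log ω o` is the largest indecomposable ordinal `≤ o`. -/
noncomputable def stdBlocks (o : Ordinal.{0}) : ℕ :=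
  Cardinal.toNat (o / omega0 ^ log omega0 o).card

/-- The upper mean `M̄` of a transfinite sequence of reals.  A sequence of length `o`
is encoded as a total function `f : Ordinal → ℝ`; only the values of `f` at ordinals
`< o` are ever used.  It is defined by transfinite recursion on `o`:
(1) for `o = 1` it is `f 0`;
(2) for `o` indecomposable with `o > 1` (i.e. `o = ω^σ` with `σ > 0`) it is
    `limsup_{ξ → o} M̄(f|_ξ) = inf_{1 ≤ ζ < o} sup_{ζ ≤ ξ < o} M̄(f|_ξ)`;
(3) for decomposable `o`, writing `o = ω^σ·n + ρ` with `ρ < ω^σ`, it is the average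
    `(1/n) (M̄(s₀) + ⋯ + M̄(s_{n-1}))` of the upper means of the `n` consecutive
    blocks of `f` of length `ω^σ` (the remainder of length `ρ` is discarded). -/
noncomputable def upperMean (o : Ordinal.{0}) (f : Ordinal.{0} → ℝ) : ℝ :=
  if o = 1 then f 0
  else if h1 : 1 < o ∧ o = omega0 ^ log omega0 o then
    ⨅ ζ : Set.Ico (1 : Ordinal.{0}) o, ⨆ ξ : Set.Ico ζ.1 o, upperMean ξ.1 f
  else if h2 : 1 < o then
    ((stdBlocks o : ℝ))⁻¹ *
      ∑ i ∈ Finset.range (stdBlocks o),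
        upperMean (omega0 ^ log omega0 o)
          (fun ξ => f (omega0 ^ log omega0 o * (i : Ordinal) + ξ))
  else 0
termination_by o
decreasing_by
  · exact ξ.2.2
  · exact lt_of_le_of_ne (opow_log_le_self _ (zero_lt_one.trans h2).ne')
      fun h => h1 ⟨h2, h.symm⟩

/-- A transfinite sequence of reals of length `o` is bounded if its range
(on indices `< o`) is bounded in `ℝ`. -/
def SeqBounded (o : Ordinal.{0}) (f : Ordinal.{0} → ℝ) : Prop :=
  ∃ C : ℝ, ∀ ξ < o, |f ξ| ≤ C

/-- The concatenation `r ⊕ s` of a sequence `r` of length `a` with a sequence `s`: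
its first `a` entries are those of `r`, and its entry at `a + ξ'` is `s ξ'`. -/
noncomputable def concatSeq (a : Ordinal.{0}) (r s : Ordinal.{0} → ℝ) :
    Ordinal.{0} → ℝ :=
  fun ξ => if ξ < a then r ξ else s (ξ - a)

/-- An ordinal is indecomposable if it is nonzero and not the sum of two strictly
smaller ordinals. -/
def IsIndecomposable (o : Ordinal.{0}) : Prop :=
  o ≠ 0 ∧ ∀ b < o, ∀ c < o, b + c ≠ o

/-- The concatenation `s₀ ⊕ s₁ ⊕ ⋯ ⊕ s_{n-1}` of `n` sequences, each of length `β`;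
the result has length `β * n`. -/
noncomputable def concatN (β : Ordinal.{0}) :
    (n : ℕ) → (Fin n → Ordinal.{0} → ℝ) → Ordinal.{0} → ℝ
  | 0, _ => fun _ => 0
  | n + 1, s => concatSeq (β * n) (concatN β n (fun i => s i.castSucc)) (s (Fin.last n))

/-- `s / β`: given a sequence `s` whose length is `β * α`, the sequence of length `α`
whose `ι`-th entry is the upper mean of the `ι`-th consecutive block of `s` of
length `β`. -/
noncomputable def seqDiv (s : Ordinal.{0} → ℝ) (β : Ordinal.{0}) : Ordinal.{0} → ℝ :=
  fun ι => upperMean β (fun ξ => s (β * ι + ξ))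

/-- The lower mean `𝕄̲(s) = -M̄(-s)`. -/
noncomputable def lowerMean (o : Ordinal.{0}) (s : Ordinal.{0} → ℝ) : ℝ :=
  - upperMean o (fun ξ => - s ξ)

/-- A sequence `s` of length `o` has mean `c` when its upper and lower means both
equal `c`. -/
def HasMean (o : Ordinal.{0}) (s : Ordinal.{0} → ℝ) (c : ℝ) : Prop :=
  upperMean o s = c ∧ lowerMean o s = c

open MeasureTheory

lemma natCast_stdBlocks {o : Ordinal.{0}} :
    (stdBlocks o : Ordinal.{0}) = o / ω ^ log ω o := by
  obtain ⟨n, hn⟩ := lt_omega0.1 (div_opow_log_lt o one_lt_omega0)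
  simp [stdBlocks, hn]

lemma stdBlocks_pos {o : Ordinal.{0}} (ho : o ≠ 0) : 0 < stdBlocks o := by
  have h := div_opow_log_pos ω ho
  rw [← natCast_stdBlocks] at h
  exact_mod_cast h

lemma mul_stdBlocks_le (o : Ordinal.{0}) : ω ^ log ω o * stdBlocks o ≤ o := by
  rw [natCast_stdBlocks]
  exact mul_div_le _ _

lemma le_stdBlocks {o : Ordinal.{0}} {n : ℕ} (h : ω ^ log ω o * n ≤ o) : n ≤ stdBlocks o := by
  have h' : (n : Ordinal.{0}) ≤ stdBlocks o := by
    rw [natCast_stdBlocks, ← mul_le_iff_le_div (opow_pos _ omega0_pos).ne']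
    exact h
  exact_mod_cast h'

lemma upperMean_one (f : Ordinal.{0} → ℝ) : upperMean 1 f = f 0 := by
  rw [upperMean]; simp

lemma upperMean_zero (f : Ordinal.{0} → ℝ) : upperMean 0 f = 0 := by
  rw [upperMean]; simp

lemma upperMean_of_indecomposable {o : Ordinal.{0}} (h1 : 1 < o) (ho : ω ^ log ω o = o)
    (f : Ordinal.{0} → ℝ) :
    upperMean o f = ⨅ ζ : Set.Ico (1 : Ordinal.{0}) o, ⨆ ξ : Set.Ico ζ.1 o, upperMean ξ.1 f := by
  rw [upperMean, if_neg h1.ne', dif_pos ⟨h1, ho.symm⟩]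

/-- The averaging formula holds for every nonzero length, with a single block when the length
is indecomposable. -/
lemma upperMean_eq_average {o : Ordinal.{0}} (ho : o ≠ 0) (f : Ordinal.{0} → ℝ) :
    upperMean o f = (stdBlocks o : ℝ)⁻¹ * ∑ i ∈ Finset.range (stdBlocks o),
      upperMean (ω ^ log ω o) (fun ξ => f (ω ^ log ω o * (i : Ordinal) + ξ)) := by
  by_cases h : ω ^ log ω o = o
  · have hb : stdBlocks o = 1 := by
      have := natCast_stdBlocks (o := o)
      rw [h, Ordinal.div_self ho] at this
      exact_mod_cast this
    simp [hb, h]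
  · have h1 : 1 < o := by
      refine lt_of_le_of_ne (Order.one_le_iff_pos.2 (pos_iff_ne_zero.2 ho)) ?_
      rintro rfl
      simp at h
    rw [upperMean, if_neg h1.ne', dif_neg (fun h' => h h'.2.symm), dif_pos h1]

lemma average_mem_Icc {n : ℕ} (hn : 0 < n) {v : ℕ → ℝ} (hv : ∀ i < n, v i ∈ Set.Icc (0 : ℝ) 1) :
    (n : ℝ)⁻¹ * ∑ i ∈ Finset.range n, v i ∈ Set.Icc (0 : ℝ) 1 := by
  have hn' : (0 : ℝ) < n := by exact_mod_cast hn
  refine ⟨mul_nonneg (by positivity)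
    (Finset.sum_nonneg fun i hi => (hv i (Finset.mem_range.1 hi)).1), ?_⟩
  rw [inv_mul_le_iff₀ hn', mul_one]
  simpa using Finset.sum_le_card_nsmul _ _ 1 fun i hi => (hv i (Finset.mem_range.1 hi)).2

lemma upperMean_mem_Icc (o : Ordinal.{0}) :
    ∀ f : Ordinal.{0} → ℝ, (∀ ξ, f ξ ∈ Set.Icc (0 : ℝ) 1) → upperMean o f ∈ Set.Icc (0 : ℝ) 1 := by
  induction o using WellFoundedLT.induction with
  | _ o ih =>
  intro f hf
  rcases eq_or_ne o 0 with rfl | ho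
  · simp [upperMean_zero]
  rcases eq_or_ne o 1 with rfl | ho1
  · rw [upperMean_one]; exact hf 0
  have h1 : 1 < o := lt_of_le_of_ne (Order.one_le_iff_pos.2 (pos_iff_ne_zero.2 ho)) ho1.symm
  by_cases h : ω ^ log ω o = o
  · rw [upperMean_of_indecomposable h1 h]
    have hsup : ∀ ζ : Set.Ico (1 : Ordinal.{0}) o,
        (⨆ ξ : Set.Ico ζ.1 o, upperMean ξ.1 f) ∈ Set.Icc (0 : ℝ) 1 := fun ζ =>
      ⟨Real.iSup_nonneg fun ξ => (ih ξ.1 ξ.2.2 f hf).1,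
        Real.iSup_le (fun ξ => (ih ξ.1 ξ.2.2 f hf).2) zero_le_one⟩
    exact ⟨Real.iInf_nonneg fun ζ => (hsup ζ).1,
      (ciInf_le ⟨0, by rintro _ ⟨ζ, rfl⟩; exact (hsup ζ).1⟩ ⟨1, le_rfl, h1⟩).trans (hsup _).2⟩
  · rw [upperMean_eq_average ho]
    exact average_mem_Icc (stdBlocks_pos ho) fun i _ =>
      ih _ (lt_of_le_of_ne (opow_log_le_self _ ho) h) _ fun ξ => hf _

lemma bddAbove_range_upperMean {f : Ordinal.{0} → ℝ} (hf : ∀ ξ, f ξ ∈ Set.Icc (0 : ℝ) 1)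
    (s : Set Ordinal.{0}) : BddAbove (Set.range fun ξ : s => upperMean ξ.1 f) :=
  ⟨1, by rintro _ ⟨ξ, rfl⟩; exact (upperMean_mem_Icc _ _ hf).2⟩

lemma bddBelow_range_iSup_upperMean {f : Ordinal.{0} → ℝ} (hf : ∀ ξ, f ξ ∈ Set.Icc (0 : ℝ) 1)
    (o : Ordinal.{0}) : BddBelow (Set.range fun ζ : Set.Ico (1 : Ordinal.{0}) o =>
      ⨆ ξ : Set.Ico ζ.1 o, upperMean ξ.1 f) :=
  ⟨0, by rintro _ ⟨ζ, rfl⟩; exact Real.iSup_nonneg fun ξ => (upperMean_mem_Icc _ _ hf).1⟩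

lemma upperMean_mono (o : Ordinal.{0}) : ∀ f g : Ordinal.{0} → ℝ,
    (∀ ξ, f ξ ∈ Set.Icc (0 : ℝ) 1) → (∀ ξ, g ξ ∈ Set.Icc (0 : ℝ) 1) → (∀ ξ, f ξ ≤ g ξ) →
      upperMean o f ≤ upperMean o g := by
  induction o using WellFoundedLT.induction with
  | _ o ih =>
  intro f g hf hg hfg
  rcases eq_or_ne o 0 with rfl | ho
  · simp [upperMean_zero]
  rcases eq_or_ne o 1 with rfl | ho1
  · rw [upperMean_one, upperMean_one]; exact hfg 0
  have h1 : 1 < o := lt_of_le_of_ne (Order.one_le_iff_pos.2 (pos_iff_ne_zero.2 ho)) ho1.symm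
  by_cases h : ω ^ log ω o = o
  · rw [upperMean_of_indecomposable h1 h, upperMean_of_indecomposable h1 h]
    exact ciInf_mono (bddBelow_range_iSup_upperMean hf o) fun ζ =>
      ciSup_mono (bddAbove_range_upperMean hg _) fun ξ => ih ξ.1 ξ.2.2 f g hf hg hfg
  · rw [upperMean_eq_average ho, upperMean_eq_average ho]
    gcongr with i
    exact ih _ (lt_of_le_of_ne (opow_log_le_self _ ho) h) _ _ (fun _ => hf _) (fun _ => hg _)
      fun _ => hfg _

/-- At an indecomposable length the upper mean is the limit of the upper means of the initial
segments, if these converge. -/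
lemma upperMean_eq_of_forall_abs_sub_le {o : Ordinal.{0}} (h1 : 1 < o) (ho : ω ^ log ω o = o)
    {f : Ordinal.{0} → ℝ} (hf : ∀ ξ, f ξ ∈ Set.Icc (0 : ℝ) 1) {c : ℝ}
    (h : ∀ ε > 0, ∃ ζ < o, ∀ ξ, ζ ≤ ξ → ξ < o → |upperMean ξ f - c| ≤ ε) :
    upperMean o f = c := by
  rw [upperMean_of_indecomposable h1 ho]
  refine eq_of_forall_dist_le fun ε hε => ?_
  obtain ⟨ζ, hζ, H⟩ := h ε hε
  rw [Real.dist_eq, abs_sub_le_iff, sub_le_iff_le_add, sub_le_comm]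
  constructor
  · have hζ' : max ζ 1 < o := max_lt hζ h1
    refine (ciInf_le (bddBelow_range_iSup_upperMean hf o) ⟨max ζ 1, le_max_right _ _, hζ'⟩).trans ?_
    have : Nonempty (Set.Ico (max ζ 1) o) := ⟨⟨_, le_rfl, hζ'⟩⟩
    exact ciSup_le fun ξ => by
      have := (abs_sub_le_iff.1 (H ξ.1 ((le_max_left _ _).trans ξ.2.1) ξ.2.2)).1
      linarith
  · have : Nonempty (Set.Ico (1 : Ordinal.{0}) o) := ⟨⟨1, le_rfl, h1⟩⟩
    refine le_ciInf fun ζ' => ?_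
    refine le_trans ?_ (le_ciSup (bddAbove_range_upperMean hf _)
      (⟨max ζ ζ'.1, le_max_right _ _, max_lt hζ ζ'.2.2⟩ : Set.Ico ζ'.1 o))
    have := (abs_sub_le_iff.1 (H (max ζ ζ'.1) (le_max_left _ _) (max_lt hζ ζ'.2.2))).2
    linarith

lemma upperMean_natCast {n : ℕ} (hn : n ≠ 0) (f : Ordinal.{0} → ℝ) :
    upperMean n f = (n : ℝ)⁻¹ * ∑ i ∈ Finset.range n, f i := by
  have hlog : log ω (n : Ordinal.{0}) = 0 := log_eq_zero (natCast_lt_omega0 n)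
  have hb : stdBlocks n = n := by
    have := natCast_stdBlocks (o := (n : Ordinal.{0}))
    rw [hlog, opow_zero, div_one] at this
    exact_mod_cast this
  rw [upperMean_eq_average (by exact_mod_cast hn), hb, hlog, opow_zero]
  simp [upperMean_one]

lemma upperMean_omega0_eq_of_tendsto {f : Ordinal.{0} → ℝ} (hf : ∀ ξ, f ξ ∈ Set.Icc (0 : ℝ) 1)
    {c : ℝ} (h : Filter.Tendsto (fun n : ℕ => (n : ℝ)⁻¹ * ∑ i ∈ Finset.range n, f i)
      Filter.atTop (nhds c)) : upperMean ω f = c := by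
  have hlog : ω ^ log ω ω = ω := by
    have := log_opow one_lt_omega0 1
    rw [opow_one] at this
    rw [this, opow_one]
  refine upperMean_eq_of_forall_abs_sub_le one_lt_omega0 hlog hf fun ε hε => ?_
  obtain ⟨N, hN⟩ := Metric.tendsto_atTop.1 h ε hε
  refine ⟨(N + 1 : ℕ), natCast_lt_omega0 _, fun ξ hξ hξω => ?_⟩
  obtain ⟨n, rfl⟩ := lt_omega0.1 hξω
  have hn : N + 1 ≤ n := by exact_mod_cast hξ
  rw [upperMean_natCast (by omega), ← Real.dist_eq]
  exact (hN n (by omega)).le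

lemma exists_ord_card_eq_omega0_opow {a : Ordinal.{0}} (ha : ω ≤ a) :
    ∃ r : Ordinal.{0}, a.card.ord = ω ^ r := by
  have hc : Cardinal.aleph0 ≤ a.card := aleph0_le_card.2 ha
  rcases isPrincipal_add_iff_zero_or_omega0_opow.1 (isPrincipal_add_ord hc) with h | ⟨r, hr⟩
  · exact absurd ((Cardinal.omega0_le_ord.2 hc).trans_eq h) omega0_pos.not_ge
  · exact ⟨r, hr.symm⟩

lemma ord_card_dvd_omega0_opow {t : Ordinal.{0}} (ht : ω ≤ ω ^ t) :
    (ω ^ t).card.ord ∣ ω ^ t := by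
  obtain ⟨r, hr⟩ := exists_ord_card_eq_omega0_opow ht
  rw [hr]
  refine opow_dvd_opow _ ((opow_le_opow_iff_right one_lt_omega0).1 ?_)
  rw [← hr]
  exact Cardinal.ord_card_le _

lemma omega0_dvd_ord {c : Cardinal.{0}} (hc : Cardinal.aleph0 ≤ c) : ω ∣ c.ord :=
  isSuccPrelimit_iff_omega0_dvd.1 (Cardinal.isSuccLimit_ord hc).isSuccPrelimit

/-- The block starting points used to build capturing sequences: infinite ordinals divisible by
the initial ordinal of their cardinality. -/
def IsBlockStart (η : Ordinal.{0}) : Prop :=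
  ω ≤ η ∧ η.card.ord ∣ η

lemma isBlockStart_omega0_opow_mul {t : Ordinal.{0}} (ht : ω ≤ ω ^ t) {i : ℕ} (hi : i ≠ 0) :
    IsBlockStart (ω ^ t * i) := by
  have hle : ω ^ t ≤ ω ^ t * i :=
    le_mul_left _ (by exact_mod_cast Nat.pos_of_ne_zero hi)
  refine ⟨ht.trans hle, ?_⟩
  have hcard : (ω ^ t * i : Ordinal.{0}).card = (ω ^ t : Ordinal.{0}).card := by
    rw [card_mul, card_nat]
    exact Cardinal.mul_eq_left (aleph0_le_card.2 ht)
      ((Cardinal.natCast_le_aleph0).trans (aleph0_le_card.2 ht)) (by exact_mod_cast hi)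
  rw [hcard]
  exact (ord_card_dvd_omega0_opow ht).mul_right _

/-- If every block of minimal length beyond `β` has upper mean `c`, then so does every longer
segment beginning at a block start beyond `β`. -/
lemma upperMean_segment_eq {Λ β : Ordinal.{0}} {f : Ordinal.{0} → ℝ}
    (hf : ∀ ξ, f ξ ∈ Set.Icc (0 : ℝ) 1) {c : ℝ}
    (H : ∀ η, β < η → IsBlockStart η → η < Λ → upperMean η.card.ord (fun ξ => f (η + ξ)) = c)
    (o : Ordinal.{0}) : ∀ η, β < η → IsBlockStart η → η + o ≤ Λ → η.card.ord ≤ o →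
      upperMean o (fun ξ => f (η + ξ)) = c := by
  induction o using WellFoundedLT.induction with
  | _ o ih =>
  intro η hβ hη hΛ ho
  have hc : Cardinal.aleph0 ≤ η.card := aleph0_le_card.2 hη.1
  have hωo : ω ≤ o := (Cardinal.omega0_le_ord.2 hc).trans ho
  have ho0 : o ≠ 0 := (omega0_pos.trans_le hωo).ne'
  rcases ho.eq_or_lt with rfl | hlt
  · exact H η hβ hη ((lt_add_of_pos_right _ (pos_iff_ne_zero.2 ho0)).trans_le hΛ)
  by_cases hb : ω ^ log ω o = o
  · refine upperMean_eq_of_forall_abs_sub_le (one_lt_omega0.trans_le hωo) hb (fun _ => hf _)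
      fun ε hε => ⟨η.card.ord, hlt, fun ξ h1 h2 => ?_⟩
    rw [ih ξ h2 η hβ hη ((add_le_add_right h2.le η).trans hΛ) h1, _root_.sub_self, abs_zero]
    exact hε.le
  set b := ω ^ log ω o with hbdef
  have hbo : b < o := lt_of_le_of_ne (opow_log_le_self _ ho0) hb
  have hηb : η.card.ord ≤ b := by
    obtain ⟨r, hr⟩ := exists_ord_card_eq_omega0_opow hη.1
    rw [hr] at ho ⊢
    exact opow_le_opow_right omega0_pos (le_log_of_opow_le one_lt_omega0 ho)
  have hωb : ω ≤ b := (Cardinal.omega0_le_ord.2 hc).trans hηb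
  have hcb : η.card ≤ b.card := Cardinal.ord_le.1 hηb
  have hcb' : Cardinal.aleph0 ≤ b.card := aleph0_le_card.2 hωb
  have key : ∀ i ∈ Finset.range (stdBlocks o),
      upperMean b (fun ξ => f (η + (b * (i : Ordinal) + ξ))) = c := by
    intro i hi
    simp_rw [← add_assoc]
    have hcard : (η + b * i).card ≤ b.card := by
      rw [card_add, card_mul, card_nat]
      exact Cardinal.add_le_of_le hcb' hcb
        (Cardinal.mul_le_of_le hcb' le_rfl (Cardinal.natCast_le_aleph0.trans hcb'))
    refine ih b hbo (η + b * i) (hβ.trans_le (le_add_right le_rfl))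
      ⟨hη.1.trans (le_add_right le_rfl), ?_⟩ ?_
      (Cardinal.ord_le.2 hcard)
    · rcases Nat.eq_zero_or_pos i with rfl | hi0
      · simpa using hη.2
      have hcard' : (η + b * i).card = b.card := by
        refine hcard.antisymm (card_le_card ?_)
        exact (le_mul_left _ (by exact_mod_cast hi0)).trans (le_add_left le_rfl)
      rw [hcard']
      have hdvd : b.card.ord ∣ b * i := (ord_card_dvd_omega0_opow hωb).mul_right _
      rcases hcb.eq_or_lt with heq | hlt'
      · rw [← heq] at hdvd ⊢
        exact (dvd_add_iff hη.2).2 hdvd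
      · have habs : η + b * i = b * i := by
          refine add_of_omega0_opow_le (b := log ω o)
            ((Cardinal.lt_ord.2 hlt').trans_le (Cardinal.ord_card_le _)) ?_
          exact le_mul_left _ (by exact_mod_cast hi0)
        rwa [habs]
    · rw [add_assoc]
      refine (add_le_add_right ?_ η).trans hΛ
      rw [← mul_add_one]
      refine le_trans ?_ (mul_stdBlocks_le o)
      refine mul_le_mul_right ?_ _
      exact_mod_cast Finset.mem_range.1 hi
  have hpos := stdBlocks_pos ho0
  rw [upperMean_eq_average ho0, Finset.sum_congr rfl key, Finset.sum_const, Finset.card_range,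
    _root_.nsmul_eq_mul, inv_mul_cancel_left₀ (by exact_mod_cast hpos.ne')]

lemma abs_average_sub_le {n : ℕ} (hn : 0 < n) {v : ℕ → ℝ} {c : ℝ}
    (hv : ∀ i < n, i ≠ 0 → v i = c) :
    |(n : ℝ)⁻¹ * ∑ i ∈ Finset.range n, v i - c| = |v 0 - c| / n := by
  have hn' : (0 : ℝ) < n := by exact_mod_cast hn
  obtain ⟨k, rfl⟩ : ∃ k, n = k + 1 := ⟨n - 1, by omega⟩
  rw [Finset.sum_range_succ', Finset.sum_congr rfl fun i hi =>
    hv (i + 1) (by have := Finset.mem_range.1 hi; omega) (by omega)]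
  rw [← abs_of_pos hn', ← abs_div, abs_of_pos hn']
  congr 1
  rw [Finset.sum_const, Finset.card_range, _root_.nsmul_eq_mul]
  field_simp
  push_cast
  ring

/-- If every block of minimal length beyond `β` has upper mean `c`, then so does every
initial segment of indecomposable length `ω ^ τ` with `β < τ`. -/
lemma upperMean_omega0_opow_eq {Λ β τ₀ : Ordinal.{0}} {f : Ordinal.{0} → ℝ}
    (hf : ∀ ξ, f ξ ∈ Set.Icc (0 : ℝ) 1) {c : ℝ} (hc : c ∈ Set.Icc (0 : ℝ) 1)
    (hβ : β < ω ^ τ₀) (hτ₀ : τ₀ ≠ 0)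
    (H : ∀ η, β < η → IsBlockStart η → η < Λ → upperMean η.card.ord (fun ξ => f (η + ξ)) = c)
    (τ : Ordinal.{0}) : τ₀ < τ → ω ^ τ ≤ Λ → upperMean (ω ^ τ) f = c := by
  induction τ using WellFoundedLT.induction with
  | _ τ ih =>
  intro hτ hΛ
  have hω₀ : ω ≤ ω ^ τ₀ := by
    simpa using opow_le_opow_right omega0_pos (Order.one_le_iff_pos.2 (pos_iff_ne_zero.2 hτ₀))
  have h1 : 1 < ω ^ τ := one_lt_omega0.trans_le
    (hω₀.trans (opow_le_opow_right omega0_pos hτ.le))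
  refine upperMean_eq_of_forall_abs_sub_le h1 (by rw [log_opow one_lt_omega0]) hf fun ε hε => ?_
  obtain ⟨N, hN⟩ := exists_nat_one_div_lt hε
  refine ⟨ω ^ τ₀ * (N + 1 : ℕ), ?_, fun ξ hξ hξτ => ?_⟩
  · refine lt_of_lt_of_le ?_ (opow_le_opow_right omega0_pos (Order.succ_le_of_lt hτ))
    rw [opow_succ]
    exact mul_lt_mul_of_pos_left (natCast_lt_omega0 _) (opow_pos _ omega0_pos)
  have hξ₀ : ω ^ τ₀ ≤ ξ :=
    (le_mul_left _ (by exact_mod_cast Nat.succ_pos N)).trans hξ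
  have hξ0 : ξ ≠ 0 := ((opow_pos _ omega0_pos).trans_le hξ₀).ne'
  have hlog : τ₀ ≤ log ω ξ := le_log_of_opow_le one_lt_omega0 hξ₀
  have hlogτ : log ω ξ < τ := (lt_opow_iff_log_lt one_lt_omega0 hξ0).1 hξτ
  have hle : ω ^ τ₀ ≤ ω ^ log ω ξ := opow_le_opow_right omega0_pos hlog
  have hpos := stdBlocks_pos hξ0
  rw [upperMean_eq_average hξ0, abs_average_sub_le hpos]
  · simp only [Nat.cast_zero, mul_zero, zero_add]
    have hmem := upperMean_mem_Icc (ω ^ log ω ξ) f hf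
    rcases hlog.eq_or_lt with heq | hlt
    · have hNle : N + 1 ≤ stdBlocks ξ := le_stdBlocks (heq ▸ hξ)
      calc |upperMean (ω ^ log ω ξ) f - c| / stdBlocks ξ ≤ 1 / ((N + 1 : ℕ) : ℝ) := by
            gcongr
            rw [abs_sub_le_iff]
            constructor <;> linarith [hmem.1, hmem.2, hc.1, hc.2]
        _ ≤ ε := by push_cast; exact hN.le
    · rw [ih _ hlogτ hlt ((opow_le_opow_right omega0_pos hlogτ.le).trans hΛ)]
      simpa using hε.le
  · intro i hi hi0
    have hle_i : ω ^ log ω ξ ≤ ω ^ log ω ξ * i :=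
      le_mul_left _ (by exact_mod_cast Nat.pos_of_ne_zero hi0)
    refine upperMean_segment_eq hf H _ _ (hβ.trans_le (hle.trans hle_i))
      (isBlockStart_omega0_opow_mul (hω₀.trans hle) hi0) ?_ ?_
    · rw [← mul_add_one]
      refine le_trans ?_ ((mul_stdBlocks_le ξ).trans (hξτ.le.trans hΛ))
      refine mul_le_mul_right ?_ _
      exact_mod_cast hi
    · refine Cardinal.ord_le.2 ?_
      have := aleph0_le_card.2 (hω₀.trans hle)
      rw [card_mul, card_nat]
      exact Cardinal.mul_le_of_le this le_rfl (Cardinal.natCast_le_aleph0.trans this)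

lemma upperMean_ord_eq_of_blocks {k : Cardinal.{0}} (hk : Cardinal.aleph0 < k) {β : Ordinal.{0}}
    (hβk : β < k.ord) {f : Ordinal.{0} → ℝ} (hf : ∀ ξ, f ξ ∈ Set.Icc (0 : ℝ) 1) {c : ℝ}
    (hc : c ∈ Set.Icc (0 : ℝ) 1)
    (H : ∀ η, β < η → IsBlockStart η → η < k.ord →
      upperMean η.card.ord (fun ξ => f (η + ξ)) = c) :
    upperMean k.ord f = c := by
  have hωk : ω ≤ k.ord := Cardinal.omega0_le_ord.2 hk.le
  obtain ⟨σ, hσ⟩ := exists_ord_card_eq_omega0_opow hωk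
  rw [Cardinal.card_ord] at hσ
  have hlt : ω ^ Order.succ β < ω ^ σ := by
    rw [← hσ]
    refine isPrincipal_opow_ord hk.le ?_ ((Cardinal.isSuccLimit_ord hk.le).succ_lt hβk)
    rw [Cardinal.lt_ord, card_omega0]
    exact hk
  have hστ := (opow_lt_opow_iff_right one_lt_omega0).1 hlt
  rw [hσ]
  refine upperMean_omega0_opow_eq (Λ := k.ord) hf hc (β := β) (τ₀ := Order.succ β)
    ?_ (Order.bot_lt_succ β).ne' H σ hστ hσ.ge
  exact (Order.lt_succ β).trans_le (right_le_opow _ one_lt_omega0)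

/-- An assignment of sets of positive measure to ordinals, unconstrained at the multiples
of `ω`; sequences will be built by choosing `x ξ ∈ P ξ`. -/
structure IsPattern {X : Type} [MeasurableSpace X] (m : Measure X) (P : Ordinal.{0} → Set X) :
    Prop where
  measurableSet : ∀ ξ, MeasurableSet (P ξ)
  measure_pos : ∀ ξ, 0 < m (P ξ)
  eq_univ : ∀ ξ, ω ∣ ξ → P ξ = Set.univ

/-- Every sequence of length `o` chosen from the pattern `P` captures the set `A`. -/
def PatternCaptures {X : Type} [MeasurableSpace X] (m : Measure X) (P : Ordinal.{0} → Set X)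
    (o : Ordinal.{0}) (A : Set X) : Prop :=
  ∀ f : Ordinal.{0} → ℝ, (∀ ξ, f ξ ∈ Set.Icc (0 : ℝ) 1) → (∀ ξ < o, P ξ ⊆ A → f ξ = 1) →
    (∀ ξ < o, Disjoint (P ξ) A → f ξ = 0) → upperMean o f = m.real A

open scoped Classical in
/-- The membership pattern of a point in the first `n` sets of a sequence of sets. -/
noncomputable def membershipCode {X : Type} (A : ℕ → Set X) (n : ℕ) (z : X) : Finset ℕ :=
  (Finset.range n).filter fun k => z ∈ A k

lemma mem_iff_of_membershipCode_eq {X : Type} {A : ℕ → Set X} {n k : ℕ} (hk : k < n) {z w : X}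
    (h : membershipCode A n w = membershipCode A n z) : w ∈ A k ↔ z ∈ A k := by
  have := Finset.ext_iff.1 h k
  simpa [membershipCode, hk] using this

section Countable

variable {X : Type} [MeasurableSpace X]

lemma measurableSet_preimage_membershipCode {A : ℕ → Set X} (hA : ∀ k, MeasurableSet (A k))
    (n : ℕ) (S : Finset ℕ) : MeasurableSet (membershipCode A n ⁻¹' {S}) := by
  have : membershipCode A n ⁻¹' {S} =
      {z | ∀ k, k ∈ S ↔ k < n ∧ z ∈ A k} := by
    ext z
    simp [membershipCode, Finset.ext_iff, iff_comm]
  rw [this]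
  simp only [Set.ofPred_forall]
  refine MeasurableSet.iInter fun k => ?_
  by_cases hk : k ∈ S <;> by_cases hn : k < n <;> simp [hk, hn]
  · exact hA k
  · exact (hA k).mem.not

lemma ae_measure_membershipCode_pos (m : Measure X) (A : ℕ → Set X) (n : ℕ) :
    ∀ᵐ z ∂m, 0 < m (membershipCode A n ⁻¹' {membershipCode A n z}) := by
  rw [ae_iff]
  refine measure_mono_null (t := ⋃ S : {S : Finset ℕ // m (membershipCode A n ⁻¹' {S}) = 0},
    membershipCode A n ⁻¹' {S.1}) ?_ (measure_iUnion_null fun S => S.2)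
  intro z hz
  exact Set.mem_iUnion.2 ⟨⟨membershipCode A n z, by simpa using hz⟩, rfl⟩

lemma ae_tendsto_average_indicator (m : Measure X) [IsProbabilityMeasure m] {A : Set X}
    (hA : MeasurableSet A) :
    ∀ᵐ y ∂(Measure.infinitePi fun _ : ℕ => m), Filter.Tendsto
      (fun n : ℕ => (n : ℝ)⁻¹ * ∑ i ∈ Finset.range n, A.indicator (fun _ => (1 : ℝ)) (y i))
      Filter.atTop (nhds (m.real A)) := by
  have hg : Measurable (A.indicator fun _ => (1 : ℝ)) := measurable_const.indicator hA
  have hmp : ∀ i : ℕ, MeasurePreserving (Function.eval i) (Measure.infinitePi fun _ : ℕ => m) m :=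
    fun i => measurePreserving_eval_infinitePi (fun _ : ℕ => m) i
  have hmap : ∀ i : ℕ, Measure.map (fun y : ℕ → X => y i) (Measure.infinitePi fun _ => m) = m :=
    fun i => (hmp i).map_eq
  have hind : ProbabilityTheory.iIndepFun
      (fun (i : ℕ) (y : ℕ → X) => A.indicator (fun _ => (1 : ℝ)) (y i))
      (Measure.infinitePi fun _ : ℕ => m) :=
    ProbabilityTheory.iIndepFun_infinitePi (P := fun _ : ℕ => m) (fun _ => hg)
  have hlaw := ProbabilityTheory.strong_law_ae_real
    (μ := Measure.infinitePi fun _ : ℕ => m)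
    (fun (i : ℕ) (y : ℕ → X) => A.indicator (fun _ => (1 : ℝ)) (y i))
    ((hmp 0).integrable_comp_of_integrable ((integrable_const (1 : ℝ)).indicator hA))
    (fun i j hij => hind.indepFun hij)
    (fun i => ⟨(hg.comp (measurable_pi_apply i)).aemeasurable,
      (hg.comp (measurable_pi_apply 0)).aemeasurable, by
        have h1 := Measure.map_map (μ := Measure.infinitePi fun _ : ℕ => m) hg
          (measurable_pi_apply i)
        have h2 := Measure.map_map (μ := Measure.infinitePi fun _ : ℕ => m) hg
          (measurable_pi_apply 0)
        rw [hmap i] at h1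
        rw [hmap 0] at h2
        exact h1.symm.trans h2⟩)
  have hint : ∫ y, A.indicator (fun _ => (1 : ℝ)) (y 0) ∂(Measure.infinitePi fun _ : ℕ => m)
      = m.real A := by
    have := integral_map (μ := Measure.infinitePi fun _ : ℕ => m)
      (measurable_pi_apply (0 : ℕ)).aemeasurable (f := A.indicator fun _ => (1 : ℝ))
      hg.aestronglyMeasurable
    rw [← this, hmap 0, integral_indicator_const _ hA]
    simp
  rw [hint] at hlaw
  filter_upwards [hlaw] with y hy
  simpa only [div_eq_inv_mul] using hy

/-- A typical point sequence for a given sequence of measurable sets. -/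
lemma exists_typical_sequence (m : Measure X) [IsProbabilityMeasure m] {A : ℕ → Set X}
    (hA : ∀ k, MeasurableSet (A k)) :
    ∃ y : ℕ → X, (∀ n, 0 < m (membershipCode A n ⁻¹' {membershipCode A n (y n)})) ∧
      ∀ k, Filter.Tendsto
        (fun n : ℕ => (n : ℝ)⁻¹ * ∑ i ∈ Finset.range n, (A k).indicator (fun _ => (1 : ℝ)) (y i))
        Filter.atTop (nhds (m.real (A k))) := by
  have h1 : ∀ᵐ y ∂(Measure.infinitePi fun _ : ℕ => m), ∀ n,
      0 < m (membershipCode A n ⁻¹' {membershipCode A n (y n)}) :=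
    ae_all_iff.2 fun n =>
      (measurePreserving_eval_infinitePi (fun _ : ℕ => m) n).quasiMeasurePreserving.ae
        (ae_measure_membershipCode_pos m A n)
  have h2 := ae_all_iff.2 fun k => ae_tendsto_average_indicator m (hA k)
  exact (h1.and h2).exists

lemma tendsto_average_of_eventually_eq {u v : ℕ → ℝ} {c : ℝ}
    (huv : ∀ᶠ n in Filter.atTop, u n = v n)
    (hv : Filter.Tendsto (fun n : ℕ => (n : ℝ)⁻¹ * ∑ i ∈ Finset.range n, v i) Filter.atTop
      (nhds c)) :
    Filter.Tendsto (fun n : ℕ => (n : ℝ)⁻¹ * ∑ i ∈ Finset.range n, u i) Filter.atTop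
      (nhds c) := by
  have h0 : Filter.Tendsto (fun n => u n - v n) Filter.atTop (nhds 0) :=
    tendsto_const_nhds.congr' (huv.mono fun n hn => by simp [hn])
  have := h0.cesaro.add hv
  simpa [← mul_add, ← Finset.sum_add_distrib] using this

lemma exists_pattern_of_countable (m : Measure X) [IsProbabilityMeasure m] {F : Set (Set X)}
    (hF : ∀ A ∈ F, MeasurableSet A) (hcount : F.Countable) :
    ∃ P, IsPattern m P ∧ ∀ A ∈ F, PatternCaptures m P ω A := by
  obtain ⟨A, hA⟩ := (hcount.insert Set.univ).exists_eq_range ⟨_, Set.mem_insert _ _⟩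
  have hAm : ∀ k, MeasurableSet (A k) := fun k => by
    rcases (hA.symm ▸ Set.mem_range_self k : A k ∈ insert Set.univ F) with h | h
    · rw [h]; exact MeasurableSet.univ
    · exact hF _ h
  obtain ⟨y, hpos, hlim⟩ := exists_typical_sequence m hAm
  let N : Ordinal.{0} → ℕ := fun ξ => Cardinal.toNat ξ.card
  classical
  refine ⟨fun ξ => if ω ∣ ξ then Set.univ else
    membershipCode A (N ξ) ⁻¹' {membershipCode A (N ξ) (y (N ξ))}, ⟨fun ξ => ?_, fun ξ => ?_,
      fun ξ hξ => if_pos hξ⟩, ?_⟩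
  · split_ifs
    exacts [MeasurableSet.univ, measurableSet_preimage_membershipCode hAm _ _]
  · split_ifs
    exacts [by simp, hpos _]
  · intro B hB f hf h1 h0
    obtain ⟨k, rfl⟩ : B ∈ Set.range A := hA ▸ Set.mem_insert_of_mem _ hB
    refine upperMean_omega0_eq_of_tendsto hf (tendsto_average_of_eventually_eq ?_ (hlim k))
    filter_upwards [Filter.eventually_gt_atTop k] with n hn
    have hdvd : ¬ ω ∣ (n : Ordinal.{0}) := fun h =>
      (natCast_lt_omega0 n).not_ge (le_of_dvd (by exact_mod_cast (by omega : n ≠ 0)) h)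
    have hN : N n = n := by simp [N]
    have h1n := h1 n (natCast_lt_omega0 n)
    have h0n := h0 n (natCast_lt_omega0 n)
    simp only [if_neg hdvd, hN] at h1n h0n
    by_cases hy : y n ∈ A k
    · rw [Set.indicator_of_mem hy]
      exact h1n fun w hw => (mem_iff_of_membershipCode_eq hn hw).2 hy
    · rw [Set.indicator_of_notMem hy]
      exact h0n (Set.disjoint_left.2 fun w hw hwA =>
        hy ((mem_iff_of_membershipCode_eq hn hw).1 hwA))

end Countable

/-- Every family `F` of sets of size at most `k` can be ranked injectively by ordinals
below `k.ord`. -/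
lemma exists_rank {X : Type} (F : Set (Set X)) {k : Cardinal.{0}} (hF : Cardinal.mk F ≤ k) :
    ∃ r : Set X → Ordinal.{0}, (∀ A ∈ F, r A < k.ord) ∧
      ∀ η, Cardinal.mk {A // A ∈ F ∧ r A < η} ≤ η.card := by
  have hF' : Cardinal.lift.{1} (Cardinal.mk F) ≤ Cardinal.mk (Set.Iio k.ord) := by
    rw [Cardinal.mk_Iio_ordinal, Cardinal.card_ord]
    exact Cardinal.lift_le.2 hF
  rw [← Cardinal.lift_id'.{0, 1} (Cardinal.mk (Set.Iio k.ord)), Cardinal.lift_mk_le'] at hF'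
  obtain ⟨g⟩ := hF'
  classical
  refine ⟨fun A => if h : A ∈ F then (g ⟨A, h⟩).1 else 0, fun A hA => ?_, fun η => ?_⟩
  · simp only [hA, dif_pos]
    exact (g _).2
  · have hinj : Function.Injective
        (fun A : {A // A ∈ F ∧ (if h : A ∈ F then (g ⟨A, h⟩).1 else 0) < η} =>
          (⟨(g ⟨A.1, A.2.1⟩).1, by have := A.2.2; rwa [dif_pos A.2.1] at this⟩ : Set.Iio η)) := by
      intro A B hAB
      have h := g.injective (Subtype.ext (Subtype.mk.inj hAB))
      exact Subtype.ext (Subtype.mk.inj h)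
    have h := Cardinal.lift_mk_le_lift_mk_of_injective hinj
    rwa [Cardinal.mk_Iio_ordinal, Cardinal.lift_uzero, Cardinal.lift_le] at h

/-- Gluing patterns along the canonical decomposition of ordinals into blocks of minimal length:
the pattern `Q η` is used on the block starting at `η`. -/
noncomputable def gluePattern {X : Type} (Q : Ordinal.{0} → Ordinal.{0} → Set X)
    (ξ : Ordinal.{0}) : Set X :=
  Q (ξ.card.ord * (ξ / ξ.card.ord)) (ξ % ξ.card.ord)

lemma gluePattern_add {X : Type} (Q : Ordinal.{0} → Ordinal.{0} → Set X) {η δ : Ordinal.{0}}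
    (hη : IsBlockStart η) (hδ : δ < η.card.ord) : gluePattern Q (η + δ) = Q η δ := by
  have hc : Cardinal.aleph0 ≤ η.card := aleph0_le_card.2 hη.1
  have hcard : (η + δ).card = η.card := by
    rw [card_add]
    exact Cardinal.add_eq_left hc (Cardinal.lt_ord.1 hδ).le
  have aux : ∀ μ q : Ordinal.{0}, δ < μ →
      Q (μ * ((μ * q + δ) / μ)) ((μ * q + δ) % μ) = Q (μ * q) δ := fun μ q h => by
    rw [mul_add_div _ (pos_of_gt h).ne', div_eq_zero_of_lt h, add_zero, mul_add_mod_self,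
      mod_eq_of_lt h]
  obtain ⟨q, hq⟩ := hη.2
  have := aux η.card.ord q hδ
  rw [← hq] at this
  rwa [gluePattern, hcard]

lemma isPattern_gluePattern {X : Type} [MeasurableSpace X] {m : Measure X}
    {Q : Ordinal.{0} → Ordinal.{0} → Set X} (hQ : ∀ η, IsPattern m (Q η)) :
    IsPattern m (gluePattern Q) := by
  refine ⟨fun ξ => (hQ _).measurableSet _, fun ξ => (hQ _).measure_pos _, fun ξ hξ => ?_⟩
  refine (hQ _).eq_univ _ ?_
  rcases eq_or_ne ξ 0 with rfl | h0
  · simp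
  have hωξ : ω ≤ ξ := le_of_dvd h0 hξ
  have hd := omega0_dvd_ord (aleph0_le_card.2 hωξ)
  refine (dvd_add_iff (hd.mul_right (ξ / ξ.card.ord))).1 ?_
  rwa [div_add_mod]

lemma exists_pattern {X : Type} [MeasurableSpace X] (m : Measure X) [IsProbabilityMeasure m]
    (k : Cardinal.{0}) : Cardinal.aleph0 ≤ k → ∀ F : Set (Set X), (∀ A ∈ F, MeasurableSet A) →
      Cardinal.mk F ≤ k → ∃ P, IsPattern m P ∧ ∀ A ∈ F, PatternCaptures m P k.ord A := by
  induction k using WellFoundedLT.induction with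
  | _ k ih =>
  intro hk F hF hFk
  rcases hk.eq_or_lt with rfl | hlt
  · rw [Cardinal.ord_aleph0]
    exact exists_pattern_of_countable m hF (Cardinal.mk_le_aleph0_iff.1 hFk)
  obtain ⟨r, hr, hrcard⟩ := exists_rank F hFk
  have hex : ∀ η : Ordinal.{0}, ∃ Q, IsPattern m Q ∧ (ω ≤ η → η < k.ord →
      ∀ A ∈ F, r A < η → PatternCaptures m Q η.card.ord A) := by
    intro η
    by_cases h : ω ≤ η ∧ η < k.ord
    · obtain ⟨Q, hQ, hQF⟩ := ih η.card (Cardinal.lt_ord.1 h.2) (aleph0_le_card.2 h.1)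
        {A | A ∈ F ∧ r A < η} (fun A hA => hF A hA.1) (hrcard η)
      exact ⟨Q, hQ, fun _ _ A hA hAη => hQF A ⟨hA, hAη⟩⟩
    · exact ⟨fun _ => Set.univ, ⟨fun _ => MeasurableSet.univ, fun _ => by simp, fun _ _ => rfl⟩,
        fun h1 h2 => absurd ⟨h1, h2⟩ h⟩
  choose Q hQ hQF using hex
  refine ⟨gluePattern Q, isPattern_gluePattern hQ, fun A hA f hf h1 h0 => ?_⟩
  refine upperMean_ord_eq_of_blocks hlt (hr A hA) hf ⟨measureReal_nonneg, measureReal_le_one⟩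
    fun η hAη hη hηk => ?_
  have hlt' : ∀ δ < η.card.ord, η + δ < k.ord := fun δ hδ =>
    isPrincipal_add_ord hk hηk (hδ.trans_le ((Cardinal.ord_card_le η).trans hηk.le))
  refine hQF η hη.1 hηk A hA hAη _ (fun _ => hf _) (fun δ hδ hsub => ?_) fun δ hδ hdis => ?_
  · exact h1 _ (hlt' δ hδ) (by rwa [gluePattern_add Q hη hδ])
  · exact h0 _ (hlt' δ hδ) (by rwa [gluePattern_add Q hη hδ])

lemma aleph0_lt_mk_of_atomless {X : Type} [MeasurableSpace X] (m : Measure X)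
    [IsProbabilityMeasure m]
    (hatomless : ∀ Y : Set X, MeasurableSet Y → 0 < m Y →
      ∃ Z ⊆ Y, MeasurableSet Z ∧ 0 < m Z ∧ m Z < m Y) :
    Cardinal.aleph0 < Cardinal.mk X := by
  by_contra! h
  have : Countable X := Cardinal.mk_le_aleph0_iff.1 h
  have hpos : ∃ z, m (measurableAtom z) ≠ 0 := by
    by_contra! h0
    have huniv : m Set.univ = 0 := measure_mono_null
      (fun z _ => Set.mem_iUnion.2 ⟨z, mem_measurableAtom_self z⟩) (measure_iUnion_null h0)
    simp at huniv
  obtain ⟨z, hz⟩ := hpos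
  obtain ⟨Z, hZ, hZm, hZpos, hlt⟩ := hatomless _
    (MeasurableSet.measurableAtom_of_countable z) (pos_iff_ne_zero.2 hz)
  obtain ⟨w, hw⟩ := nonempty_of_measure_ne_zero hZpos.ne'
  have := measurableAtom_subset hZm hw
  rw [measurableAtom_eq_of_mem (hZ hw)] at this
  exact (measure_mono this).not_gt hlt

/-- A transfinite sequence running injectively through all of `X`, with terms prescribed by a
pattern. -/
lemma exists_bijOn_mem_pattern {X : Type} [MeasurableSpace X] {m : Measure X}
    (hk : Cardinal.aleph0 < Cardinal.mk X) {P : Ordinal.{0} → Set X} (hP : IsPattern m P)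
    (hYX : ∀ Y : Set X, MeasurableSet Y → 0 < m Y → Cardinal.mk Y = Cardinal.mk X) :
    ∃ x : Ordinal.{0} → X, Set.BijOn x (Set.Iio (Cardinal.mk X).ord) Set.univ ∧
      ∀ ξ, x ξ ∈ P ξ := by
  have hcard : Cardinal.lift.{1} (Cardinal.mk X) ≤ Cardinal.mk (Set.Iio (Cardinal.mk X).ord) := by
    rw [Cardinal.mk_Iio_ordinal, Cardinal.card_ord]
  rw [← Cardinal.lift_id'.{0, 1} (Cardinal.mk (Set.Iio _)), Cardinal.lift_mk_le'] at hcard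
  obtain ⟨g⟩ := hcard
  have hstep : ∀ (ξ : Ordinal.{0}) (U : Set X), ∃ y, y ∈ P ξ ∧
      (Cardinal.mk U < Cardinal.mk X → y ∉ U) ∧
      ∀ z, ξ = ω * (g z).1 → z ∈ U ∨ y = z := by
    intro ξ U
    by_cases h : ∃ z, ξ = ω * (g z).1 ∧ z ∉ U
    · obtain ⟨z, hz, hzU⟩ := h
      refine ⟨z, ?_, fun _ => hzU, fun w hw => Or.inr ?_⟩
      · rw [hP.eq_univ ξ ⟨_, hz⟩]; trivial
      · refine g.injective (Subtype.ext ?_)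
        exact mul_left_cancel₀ omega0_ne_zero (hz.symm.trans hw)
    · push Not at h
      by_cases hU : (P ξ \ U).Nonempty
      · obtain ⟨y, hy⟩ := hU
        exact ⟨y, hy.1, fun _ => hy.2, fun z hz => Or.inl (h z hz)⟩
      · obtain ⟨y, hy⟩ := nonempty_of_measure_ne_zero (hP.measure_pos ξ).ne'
        refine ⟨y, hy, fun hlt => absurd hlt ?_, fun z hz => Or.inl (h z hz)⟩
        rw [Set.not_nonempty_iff_eq_empty, Set.sdiff_eq_empty] at hU
        rw [not_lt, ← hYX _ (hP.measurableSet ξ) (hP.measure_pos ξ)]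
        exact Cardinal.mk_le_mk_of_subset hU
  choose F hFP hFU hFz using hstep
  obtain ⟨x, hx⟩ : ∃ x : Ordinal.{0} → X, ∀ ξ, x ξ = F ξ (x '' Set.Iio ξ) := by
    let G : ∀ ξ : Ordinal.{0}, (∀ ζ, ζ < ξ → X) → X := fun ξ p =>
      F ξ (Set.range fun ζ : Set.Iio ξ => p ζ.1 ζ.2)
    refine ⟨WellFoundedLT.fix G, fun ξ => ?_⟩
    rw [WellFoundedLT.fix_eq, Set.image_eq_range]
  have hnotMem : ∀ ξ < (Cardinal.mk X).ord, x ξ ∉ x '' Set.Iio ξ := by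
    intro ξ hξ
    rw [hx ξ]
    refine hFU ξ _ ?_
    have := Cardinal.mk_image_le_lift (f := x) (s := Set.Iio ξ)
    rw [Cardinal.mk_Iio_ordinal, Cardinal.lift_uzero, Cardinal.lift_le] at this
    exact this.trans_lt (Cardinal.lt_ord.1 hξ)
  refine ⟨x, ⟨fun _ _ => trivial, ?_, ?_⟩, fun ξ => hx ξ ▸ hFP ξ _⟩
  · intro ξ hξ ζ hζ h
    rcases lt_trichotomy ξ ζ with hlt | heq | hlt
    · exact absurd ⟨ξ, hlt, h⟩ (hnotMem ζ hζ)
    · exact heq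
    · exact absurd ⟨ζ, hlt, h.symm⟩ (hnotMem ξ hξ)
  · intro z _
    have hlt : ω * (g z).1 < (Cardinal.mk X).ord := by
      refine isPrincipal_mul_ord hk.le ?_ (g z).2
      rw [Cardinal.lt_ord, card_omega0]
      exact hk
    rcases hFz _ (x '' Set.Iio (ω * (g z).1)) z rfl with ⟨ζ, hζ, h⟩ | h
    · exact ⟨ζ, lt_trans hζ hlt, h⟩
    · exact ⟨_, hlt, (hx _).trans h⟩

lemma indicator_one_mem_Icc {X : Type*} (C : Set X) (z : X) :
    C.indicator (fun _ => (1 : ℝ)) z ∈ Set.Icc (0 : ℝ) 1 := by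
  by_cases h : z ∈ C <;> simp [h]

/-- Corollary: capturing the completion.  Under the hypotheses of
Statement 11, there is a bijection `x` from the ordinals below the initial ordinal
of `card X` onto `X` capturing the completion of `(X, Σ, m)`: whenever `A' ⊆ X`
differs from a measurable `A` by a subset of a measurable null set `B`,
`M̄(A'x) = m A`. -/
theorem exists_wellOrdering_capturing_completion {X : Type} [MeasurableSpace X]
    (m : Measure X) [IsProbabilityMeasure m]
    (hatomless : ∀ Y : Set X, MeasurableSet Y → 0 < m Y →
      ∃ Z ⊆ Y, MeasurableSet Z ∧ 0 < m Z ∧ m Z < m Y)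
    (hSigmaX : Cardinal.mk {A : Set X // MeasurableSet A} ≤ Cardinal.mk X)
    (hYX : ∀ Y : Set X, MeasurableSet Y → 0 < m Y → Cardinal.mk Y = Cardinal.mk X) :
    ∃ x : Ordinal.{0} → X,
      Set.BijOn x (Set.Iio (Cardinal.mk X).ord) Set.univ ∧
      ∀ A : Set X, MeasurableSet A → ∀ A' : Set X,
        (∃ B : Set X, MeasurableSet B ∧ m B = 0 ∧ symmDiff A A' ⊆ B) →
        upperMean (Cardinal.mk X).ord
          (fun ξ => A'.indicator (fun _ => (1 : ℝ)) (x ξ)) = (m A).toReal := by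
  have hk := aleph0_lt_mk_of_atomless m hatomless
  obtain ⟨P, hP, hcap⟩ := exists_pattern m (Cardinal.mk X) hk.le {A | MeasurableSet A}
    (fun _ hA => hA) hSigmaX
  obtain ⟨x, hbij, hxP⟩ := exists_bijOn_mem_pattern hk hP hYX
  refine ⟨x, hbij, fun A hA A' ⟨B, hB, hB0, hsub⟩ => ?_⟩
  have hcapx : ∀ C : Set X, MeasurableSet C →
      upperMean (Cardinal.mk X).ord (fun ξ => C.indicator (fun _ => (1 : ℝ)) (x ξ)) = m.real C :=
    fun C hC => hcap C hC _ (fun ξ => indicator_one_mem_Icc C _)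
      (fun ξ _ h => Set.indicator_of_mem (h (hxP ξ)) _)
      (fun ξ _ h => Set.indicator_of_notMem (Set.disjoint_left.1 h (hxP ξ)) _)
  have hlo : A \ B ⊆ A' := fun z hz => by
    by_contra h
    exact hz.2 (hsub (Or.inl ⟨hz.1, h⟩))
  have hhi : A' ⊆ A ∪ B := fun z hz => by
    by_cases h : z ∈ A
    · exact Or.inl h
    · exact Or.inr (hsub (Or.inr ⟨hz, h⟩))
  have hmono : ∀ C D : Set X, C ⊆ D →
      upperMean (Cardinal.mk X).ord (fun ξ => C.indicator (fun _ => (1 : ℝ)) (x ξ)) ≤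
        upperMean (Cardinal.mk X).ord (fun ξ => D.indicator (fun _ => (1 : ℝ)) (x ξ)) :=
    fun C D hCD => upperMean_mono _ _ _ (fun _ => indicator_one_mem_Icc C _)
      (fun _ => indicator_one_mem_Icc D _)
      fun _ => Set.indicator_le_indicator_of_subset hCD (fun _ => zero_le_one) _
  have h1 := hmono _ _ hlo
  have h2 := hmono _ _ hhi
  rw [hcapx _ (hA.diff hB), measureReal_def, measure_sdiff_null hB0] at h1
  have hAB : m (A ∪ B) = m A :=
    le_antisymm ((measure_union_le A B).trans (by simp [hB0])) (measure_mono Set.subset_union_left)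
  rw [hcapx _ (hA.union hB), measureReal_def, hAB] at h2
  exact le_antisymm h2 h1
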